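/- arXiv:1005.2243 — 4 statements merged into one kernel-verified Lean document; each statement's English description precedes it below -/
import Mathlib

section
/- Let (Z, ρ) be a metric space, H a hypothesis set, l : H × Z → ℝ a loss function, and A : Z^n → H a learning algorithm. Fix γ > 0 and suppose that for every training set s ∈ Z^n and all z_1, z_2 ∈ Z with z_1 a training sample of s and ρ(z_1, z_2) ≤ γ, one has |l(A_s, z_1) − l(A_s, z_2)| ≤ ε(s). If Z admits a finite γ/2-cover of cardinality N (i.e., there are points c_1,…,c_N ∈ Z such that every z ∈ Z satisfies ρ(z, c_i) ≤ γ/2 for some i), then A is (N, ε(·))-robust: Z can be partitioned into N disjoint sets C_1,…,C_N such that for every training set s, every training sample s_j and every z lying in a common C_i satisfy |l(A_s, s_j) − l(A_s, z)| ≤ ε(s). -/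
/-- **Covering numbers turn local similarity of losses into robustness.**
If testing on a point within distance `γ` of a training sample changes the loss
by at most `ε(s)`, and `Z` has a finite `γ/2`-cover of cardinality `N`, then
the algorithm is `(N, ε(·))`-robust. -/
theorem robust_of_cover
    {Z : Type*} [MetricSpace Z] {H : Type*}
    (l : H → Z → ℝ) (n : ℕ) (A : (Fin n → Z) → H) (ε : (Fin n → Z) → ℝ)
    (γ : ℝ) (hγ : 0 < γ)
    (hloss : ∀ (s : Fin n → Z) (j : Fin n) (z : Z),
      dist (s j) z ≤ γ → |l (A s) (s j) - l (A s) z| ≤ ε s)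
    (N : ℕ) (c : Fin N → Z)
    (hcover : ∀ z : Z, ∃ i, dist z (c i) ≤ γ / 2) :
    ∃ C : Fin N → Set Z,
      Pairwise (Function.onFun Disjoint C) ∧
      (⋃ i, C i) = Set.univ ∧
      (∀ (s : Fin n → Z) (j : Fin n) (z : Z) (i : Fin N),
        s j ∈ C i → z ∈ C i → |l (A s) (s j) - l (A s) z| ≤ ε s) := by
  choose f hf using hcover
  refine ⟨fun i => f ⁻¹' {i}, pairwise_disjoint_fiber f, ?_, ?_⟩
  · ext z
    simp
  · rintro s j z i hs hz
    have hs' : f (s j) = i := hs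
    have hz' : f z = i := hz
    apply hloss
    have h₁ := hf (s j)
    have h₂ := hf z
    rw [hs'] at h₁
    rw [hz'] at h₂
    linarith [dist_triangle_right (s j) z (c i)]
end

section
/- Let X be a set partitioned into K disjoint sets C_1,…,C_K, let Y = {−1, +1}, and let Z = Y × X. Given a training set s = ((y_1,x_1),…,(y_n,x_n)) ∈ Z^n, the Majority Voting classifier labels a point x ∈ X by A_s(x) = +1 if the number of training samples (y_i, x_i) with x_i in the same partition set as x and y_i = +1 is at least the number of those with y_i = −1, and A_s(x) = −1 otherwise. Suppose the loss has the form l(A_s, z) = f(z_y, A_s(z_x)) for some function f : Y × Y → ℝ. Then Majority Voting is (2K, 0)-robust: Z can be partitioned into 2K disjoint sets such that for every training set s, whenever a training sample s_j and a point z lie in a common set of the partition, l(A_s, s_j) = l(A_s, z). -/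
open scoped Classical

/-- The label set `Y = {−1, +1}` (as a subtype of `ℤ`). -/
def Lbl : Type := {y : ℤ // y = -1 ∨ y = 1}

/-- The label `+1`. -/
def Lbl.pos : Lbl := ⟨1, Or.inr rfl⟩

/-- The label `−1`. -/
def Lbl.neg : Lbl := ⟨-1, Or.inl rfl⟩

theorem Lbl.eq_pos_or_eq_neg (y : Lbl) : y = Lbl.pos ∨ y = Lbl.neg := by
  obtain ⟨y, rfl | rfl⟩ := y
  · exact Or.inr rfl
  · exact Or.inl rfl

/-- **Majority Voting is `(2K, 0)`-robust.**
Given a partition of `X` into `K` sets, the Majority Voting classifier labels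
`x` by `+1` iff, within the partition set of `x`, the number of training
samples labeled `+1` is at least the number labeled `−1`. For any loss of the
form `l(A_s, z) = f(z_y, A_s(z_x))`, the sample space `Z = Y × X` can be
partitioned into `2K` disjoint sets on which training and testing losses
coincide exactly. -/
theorem majority_voting_robust
    {X : Type*} (K : ℕ) (C : Fin K → Set X)
    (hC_disj : Pairwise (Function.onFun Disjoint C))
    (hC_cover : (⋃ i, C i) = Set.univ)
    (n : ℕ)
    (A : (Fin n → Lbl × X) → X → Lbl)
    (hA : ∀ (s : Fin n → Lbl × X) (x : X) (k : Fin K), x ∈ C k →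
      A s x =
        if (Finset.univ.filter
              fun i => (s i).2 ∈ C k ∧ (s i).1 = Lbl.neg).card ≤
           (Finset.univ.filter
              fun i => (s i).2 ∈ C k ∧ (s i).1 = Lbl.pos).card
        then Lbl.pos else Lbl.neg)
    (f : Lbl → Lbl → ℝ) :
    ∃ D : Fin (2 * K) → Set (Lbl × X),
      Pairwise (Function.onFun Disjoint D) ∧
      (⋃ i, D i) = Set.univ ∧
      (∀ (s : Fin n → Lbl × X) (j : Fin n) (z : Lbl × X) (i : Fin (2 * K)),
        s j ∈ D i → z ∈ D i →
          f (s j).1 (A s (s j).2) = f z.1 (A s z.2)) := by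
  have hpn : Lbl.pos ≠ Lbl.neg := fun h => by
    have := congrArg Subtype.val h
    simp [Lbl.pos, Lbl.neg] at this
  obtain ⟨e⟩ : Nonempty (Lbl ≃ Fin 2) := ⟨{
    toFun := fun y => if y = Lbl.pos then 1 else 0
    invFun := fun b => if b = 1 then Lbl.pos else Lbl.neg
    left_inv := by
      intro y
      rcases Lbl.eq_pos_or_eq_neg y with rfl | rfl
      · simp
      · simp [hpn.symm]
    right_inv := by
      intro b
      fin_cases b
      · simp [hpn.symm]
      · simp }⟩
  refine ⟨fun i => {z | e z.1 = (finProdFinEquiv.symm i).1 ∧ z.2 ∈ C (finProdFinEquiv.symm i).2},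
    ?_, ?_, ?_⟩
  · intro i j hij
    refine Set.disjoint_left.2 fun z hi hj => hij ?_
    refine finProdFinEquiv.symm.injective (Prod.ext (hi.1.symm.trans hj.1) ?_)
    by_contra hne
    exact Set.disjoint_left.1 (hC_disj hne) hi.2 hj.2
  · refine Set.eq_univ_of_forall fun z => ?_
    obtain ⟨k, hk⟩ := Set.mem_iUnion.1 (hC_cover.symm ▸ Set.mem_univ z.2 : z.2 ∈ ⋃ i, C i)
    refine Set.mem_iUnion.2 ⟨finProdFinEquiv (e z.1, k), ?_⟩
    simpa only [Set.mem_ofPred_eq, Equiv.symm_apply_apply, true_and] using hk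
  · intro s j z i hj hz
    rw [e.injective (hj.1.trans hz.1.symm), hA s _ _ hj.2, hA s _ _ hz.2]
end

section
/- Fix n ≥ 1, c > 0, training data (x_1, y_1),…,(x_n, y_n) with x_i ∈ ℝ^m and y_i ∈ ℝ. Let w* ∈ ℝ^m be any minimizer over w ∈ ℝ^m of the Lasso objective (1/n)∑_{i=1}^n (y_i − w·x_i)² + c‖w‖₁. Then for any two points z_a = (y_a, x_a) and z_b = (y_b, x_b) in ℝ × ℝ^m, the absolute losses satisfy | |y_a − w*·x_a| − |y_b − w*·x_b| | ≤ ( (1/(nc))·∑_{i=1}^n y_i² + 1 )·‖z_a − z_b‖_∞, where ‖z_a − z_b‖_∞ = max(|y_a − y_b|, ‖x_a − x_b‖_∞). -/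
/-- The absolute loss of a linear predictor `w` is Lipschitz in the sup norm with constant
`‖w‖₁ + 1`. -/
theorem abs_loss_sub_abs_loss_le {ι : Type*} [Fintype ι] (w : ι → ℝ) (za zb : ℝ × (ι → ℝ)) :
    |(|za.1 - ∑ j, w j * za.2 j|) - (|zb.1 - ∑ j, w j * zb.2 j|)|
      ≤ (∑ j, |w j| + 1) * ‖za - zb‖ := by
  have h_fst : |za.1 - zb.1| ≤ ‖za - zb‖ := norm_fst_le (za - zb)
  have h_coord (j : ι) : |za.2 j - zb.2 j| ≤ ‖za - zb‖ :=
    (norm_le_pi_norm (za - zb).2 j).trans (norm_snd_le (za - zb))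
  have h_inner : |∑ j, w j * (za.2 j - zb.2 j)| ≤ (∑ j, |w j|) * ‖za - zb‖ := by
    rw [Finset.sum_mul]
    refine (Finset.abs_sum_le_sum_abs _ _).trans (Finset.sum_le_sum fun j _ => ?_)
    rw [abs_mul]
    exact mul_le_mul_of_nonneg_left (h_coord j) (abs_nonneg _)
  calc |(|za.1 - ∑ j, w j * za.2 j|) - (|zb.1 - ∑ j, w j * zb.2 j|)|
      ≤ |(za.1 - ∑ j, w j * za.2 j) - (zb.1 - ∑ j, w j * zb.2 j)| :=
        abs_abs_sub_abs_le_abs_sub _ _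
    _ = |(za.1 - zb.1) - ∑ j, w j * (za.2 j - zb.2 j)| := by
        simp only [mul_sub, Finset.sum_sub_distrib]
        congr 1
        ring
    _ ≤ |za.1 - zb.1| + |∑ j, w j * (za.2 j - zb.2 j)| := abs_sub _ _
    _ ≤ (∑ j, |w j| + 1) * ‖za - zb‖ := by linarith

/-- **Lipschitz continuity of the Lasso loss.**
If `w*` minimizes the Lasso objective `(1/n)∑(yᵢ − w·xᵢ)² + c‖w‖₁`, then for
any two points `z_a = (y_a, x_a)` and `z_b = (y_b, x_b)` in `ℝ × ℝᵐ`,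
`||y_a − w*·x_a| − |y_b − w*·x_b|| ≤ ((1/(nc))∑ yᵢ² + 1)·‖z_a − z_b‖_∞`.
(The norm on `ℝ × (Fin m → ℝ)` is the sup norm
`max(|y_a − y_b|, max_j |x_a j − x_b j|)`.) -/
theorem lasso_loss_lipschitz
    (m n : ℕ) (hn : 1 ≤ n) (c : ℝ) (hc : 0 < c)
    (x : Fin n → (Fin m → ℝ)) (y : Fin n → ℝ)
    (wstar : Fin m → ℝ)
    (hmin : ∀ w : Fin m → ℝ,
      (1 / (n : ℝ)) * (∑ i, (y i - ∑ j, wstar j * x i j) ^ 2) +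
          c * ∑ j, |wstar j|
        ≤ (1 / (n : ℝ)) * (∑ i, (y i - ∑ j, w j * x i j) ^ 2) +
          c * ∑ j, |w j|)
    (za zb : ℝ × (Fin m → ℝ)) :
    |(|za.1 - ∑ j, wstar j * za.2 j|) - (|zb.1 - ∑ j, wstar j * zb.2 j|)|
      ≤ ((1 / ((n : ℝ) * c)) * (∑ i, (y i) ^ 2) + 1) * ‖za - zb‖ := by
  have hn_pos : (0 : ℝ) < n := by exact_mod_cast hn
  have h_l1 : ∑ j, |wstar j| ≤ (1 / ((n : ℝ) * c)) * ∑ i, (y i) ^ 2 := by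
    have h_zero := hmin 0
    simp only [Pi.zero_apply, zero_mul, Finset.sum_const_zero, sub_zero, abs_zero, mul_zero,
      add_zero] at h_zero
    have h_fit : 0 ≤ (1 / (n : ℝ)) * ∑ i, (y i - ∑ j, wstar j * x i j) ^ 2 := by positivity
    rw [one_div_mul_eq_div, ← div_div, le_div_iff₀ hc, ← one_div_mul_eq_div]
    linarith
  exact (abs_loss_sub_abs_loss_le wstar za zb).trans (by gcongr)
end

section
/- Let Z be a measurable sample space, H a hypothesis set, l : H × Z → ℝ a loss function with 0 ≤ l(h,z) ≤ M, μ a probability measure on Z, and A a learning algorithm mapping finite training sets to hypotheses. Fix an infinite sequence of training samples s = (s_1, s_2, …) and write s(n) for its first n elements and A_{s(n)} for the learned hypothesis; write L(h, (z_1,…,z_n)) = (1/n)∑_{i=1}^n l(h, z_i). If A is weakly robust w.r.t. s — i.e., there exist measurable sets D_n ⊆ Z^n such that μ^n(D_n) → 1 and limsup_n sup_{ŝ(n) ∈ D_n} [ L(A_{s(n)}, ŝ(n)) − L(A_{s(n)}, s(n)) ] ≤ 0 — then A generalizes w.r.t. s: limsup_n [ E_{t∼μ} l(A_{s(n)}, t)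 − L(A_{s(n)}, s(n)) ] ≤ 0. -/
open MeasureTheory Filter

/-- The expectation of a bounded random variable is controlled by its upper bound `b` on an event,
up to the bound `M` times the probability of the complementary event. -/
lemma integral_le_add_mul_measureReal_compl {Ω : Type*} [MeasurableSpace Ω] {ν : Measure Ω}
    [IsProbabilityMeasure ν] {X : Ω → ℝ} (hX : Integrable X ν) {D : Set Ω} (hD : MeasurableSet D)
    {b M : ℝ} (hb : 0 ≤ b) (hXD : ∀ t ∈ D, X t ≤ b) (hXM : ∀ t, X t ≤ M) :
    ∫ t, X t ∂ν ≤ b + M * (1 - ν.real D) := by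
  have hint : Integrable (Dᶜ.indicator fun _ => M) ν := (integrable_const M).indicator hD.compl
  calc ∫ t, X t ∂ν ≤ ∫ t, (b + Dᶜ.indicator (fun _ => M) t) ∂ν := by
        refine integral_mono hX ((integrable_const b).add hint) fun t => ?_
        by_cases ht : t ∈ D
        · simpa [ht] using hXD t ht
        · simpa [ht] using (hXM t).trans (le_add_of_nonneg_left hb)
    _ = b + M * (1 - ν.real D) := by
        rw [integral_add (integrable_const b) hint, integral_indicator_const M hD.compl,
          probReal_compl_eq_one_sub hD]
        simp [mul_comm]

lemma integrable_average_pi {Z : Type*} [MeasurableSpace Z] {μ : Measure Z}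
    [IsProbabilityMeasure μ] {f : Z → ℝ} (hf : Integrable f μ) (n : ℕ) :
    Integrable (fun t : Fin n → Z => (1 / (n : ℝ)) * ∑ i, f (t i))
      (Measure.pi fun _ : Fin n => μ) :=
  (integrable_finsetSum _ fun i _ =>
    (measurePreserving_eval (fun _ : Fin n => μ) i).integrable_comp_of_integrable hf).const_mul _

/-- The expected average over `n` i.i.d. samples is the expectation over a single sample. -/
lemma integral_average_pi {Z : Type*} [MeasurableSpace Z] {μ : Measure Z}
    [IsProbabilityMeasure μ] {f : Z → ℝ} (hf : Integrable f μ) {n : ℕ} (hn : n ≠ 0) :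
    ∫ t : Fin n → Z, (1 / (n : ℝ)) * ∑ i, f (t i) ∂(Measure.pi fun _ : Fin n => μ)
      = ∫ z, f z ∂μ := by
  have hp (i : Fin n) := measurePreserving_eval (fun _ : Fin n => μ) i
  have heval (i : Fin n) : ∫ t : Fin n → Z, f (t i) ∂(Measure.pi fun _ : Fin n => μ)
      = ∫ z, f z ∂μ := by
    have hmap := (hp i).map_eq
    have h := integral_map (hp i).measurable.aemeasurable
      (f := f) (by rw [hmap]; exact hf.aestronglyMeasurable)
    rw [hmap] at h
    exact h.symm
  have hint (i : Fin n) : Integrable (fun t : Fin n → Z => f (t i))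
      (Measure.pi fun _ : Fin n => μ) := (hp i).integrable_comp_of_integrable hf
  rw [integral_const_mul, integral_finsetSum _ fun i _ => hint i]
  simp only [heval, Finset.sum_const, Finset.card_univ, Fintype.card_fin, nsmul_eq_mul]
  field_simp

lemma average_mem_Icc {n : ℕ} {M : ℝ} (hM : 0 ≤ M) {a : Fin n → ℝ}
    (ha : ∀ i, a i ∈ Set.Icc 0 M) : (1 / (n : ℝ)) * ∑ i, a i ∈ Set.Icc 0 M := by
  refine ⟨mul_nonneg (by positivity) (Finset.sum_nonneg fun i _ => (ha i).1), ?_⟩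
  rcases Nat.eq_zero_or_pos n with rfl | hn
  · simpa using hM
  · rw [one_div, inv_mul_le_iff₀ (by exact_mod_cast hn)]
    simpa using Finset.sum_le_sum fun i (_ : i ∈ Finset.univ) => (ha i).2

/-- A non-integrable `f` is harmless here, as its Bochner integral is `0`. -/
lemma integral_le_of_average_le {Z : Type*} [MeasurableSpace Z] {μ : Measure Z}
    [IsProbabilityMeasure μ] {f : Z → ℝ} {M : ℝ} (hM : 0 ≤ M) (hf : ∀ z, f z ∈ Set.Icc 0 M)
    {n : ℕ} (hn : n ≠ 0) {D : Set (Fin n → Z)} (hD : MeasurableSet D) {b : ℝ} (hb : 0 ≤ b)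
    (hfD : ∀ t ∈ D, (1 / (n : ℝ)) * ∑ i, f (t i) ≤ b) :
    ∫ z, f z ∂μ ≤ b + M * (1 - (Measure.pi fun _ : Fin n => μ).real D) := by
  by_cases hint : Integrable f μ
  · rw [← integral_average_pi hint hn]
    exact integral_le_add_mul_measureReal_compl (integrable_average_pi hint n) hD hb hfD
      fun t => (average_mem_Icc hM fun i => hf (t i)).2
  · rw [integral_undef hint]
    exact add_nonneg hb (mul_nonneg hM (sub_nonneg.2 measureReal_le_one))

/-- **Weak robustness implies generalization.**
Fix an infinite training sequence `s`. If there exist measurable sets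
`D_n ⊆ Z^n` with `μⁿ(D_n) → 1` and
`limsup_n sup_{ŝ(n) ∈ D_n} [L(A_{s(n)}, ŝ(n)) − L(A_{s(n)}, s(n))] ≤ 0`,
then `limsup_n [E_{t∼μ} l(A_{s(n)}, t) − L(A_{s(n)}, s(n))] ≤ 0`. -/
theorem weakly_robust_implies_generalizes
    {Z : Type*} [MeasurableSpace Z] {H : Type*}
    (l : H → Z → ℝ) (M : ℝ)
    (hl : ∀ h z, 0 ≤ l h z ∧ l h z ≤ M)
    (μ : Measure Z) [IsProbabilityMeasure μ]
    (s : ℕ → Z)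
    (A : (n : ℕ) → (Fin n → Z) → H)
    (D : (n : ℕ) → Set (Fin n → Z))
    (hD_meas : ∀ n, MeasurableSet (D n))
    (hD_prob : Tendsto
      (fun n => (Measure.pi fun _ : Fin n => μ) (D n)) atTop (nhds 1))
    (hrob : limsup (fun n =>
        sSup ((fun t : Fin n → Z =>
            (1 / (n : ℝ)) * (∑ i, l (A n fun i : Fin n => s i.1) (t i)) -
            (1 / (n : ℝ)) * (∑ i : Fin n, l (A n fun i : Fin n => s i.1) (s i.1)))
          '' D n)) atTop ≤ 0) :
    limsup (fun n =>
        (∫ t, l (A n fun i : Fin n => s i.1) t ∂μ) -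
          (1 / (n : ℝ)) * (∑ i : Fin n, l (A n fun i : Fin n => s i.1) (s i.1)))
      atTop ≤ 0 := by
  obtain ⟨z₀⟩ : Nonempty Z := nonempty_of_isProbabilityMeasure μ
  have hM : 0 ≤ M := (hl (A 0 fun i => s i) z₀).1.trans (hl _ z₀).2
  have havg (n : ℕ) (h : H) (t : Fin n → Z) :
      (1 / (n : ℝ)) * ∑ i, l h (t i) ∈ Set.Icc 0 M := average_mem_Icc hM fun i => hl h (t i)
  have hdiff (n : ℕ) (t : Fin n → Z) :
      (1 / (n : ℝ)) * (∑ i, l (A n fun i : Fin n => s i.1) (t i)) -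
        (1 / (n : ℝ)) * (∑ i : Fin n, l (A n fun i : Fin n => s i.1) (s i.1)) ≤ M := by
    have h₁ := (havg n (A n fun i => s i) t).2
    have h₂ := (havg n (A n fun i => s i) fun i => s i).1
    linarith
  have hprob : Tendsto (fun n => (Measure.pi fun _ : Fin n => μ).real (D n)) atTop (nhds 1) := by
    simpa [Measure.real, Function.comp_def] using (ENNReal.tendsto_toReal ENNReal.one_ne_top).comp hD_prob
  have htail : Tendsto (fun n => M * (1 - (Measure.pi fun _ : Fin n => μ).real (D n)))
      atTop (nhds 0) := by
    simpa using (hprob.const_sub 1).const_mul M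
  refine le_of_forall_pos_le_add fun ε hε => ?_
  refine limsup_le_of_le (IsBoundedUnder.isCoboundedUnder_le ⟨-M, eventually_map.2 ?_⟩) ?_
  · refine Eventually.of_forall fun n => ?_
    have h₁ := (havg n (A n fun i => s i) fun i => s i).2
    have h₂ : 0 ≤ ∫ t, l (A n fun i : Fin n => s i.1) t ∂μ := integral_nonneg fun t => (hl _ t).1
    simp only [ge_iff_le]
    linarith
  · have hsup := eventually_lt_of_limsup_lt (hrob.trans_lt (half_pos hε))
      ⟨M, eventually_map.2 <| Eventually.of_forall fun n =>
        Real.sSup_le (Set.forall_mem_image.2 fun t _ => hdiff n t) hM⟩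
    filter_upwards [hsup, htail.eventually_lt_const (half_pos hε), eventually_ne_atTop 0]
      with n hS hT hn
    have hc := (havg n (A n fun i => s i) fun i => s i).1
    have hbound := integral_le_of_average_le (μ := μ) hM (hl (A n fun i => s i)) hn (hD_meas n)
      (add_nonneg hc (half_pos hε).le) fun t ht => by
        have h := (le_csSup ⟨M, Set.forall_mem_image.2 fun t _ => hdiff n t⟩
          (Set.mem_image_of_mem _ ht)).trans hS.le
        linarith
    linarith
end
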